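/- arXiv:1709.06403 — 2 statements merged into one kernel-verified Lean document; each statement's English description precedes it below -/
import Mathlib

section
/- A formal topology map r : S → S′ between locally compact regular formal topologies is perfect if and only if it is cobounded, i.e. for all U ⊆ S′, U ≪′ S′ implies r⁻U ≪ S. -/
noncomputable section
open Classical

universe u v

namespace FTP

/-! ### Basic covers -/

/-- `U ◁ V` : every element of `U` is covered by `V`. -/
def covS {S : Type*} (cov : S → Set S → Prop) (U V : Set S) : Prop :=
  ∀ a ∈ U, cov a V

/-- A basic cover: reflexivity and transitivity. -/
def IsBasicCover {S : Type*} (cov : S → Set S → Prop) : Prop :=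
  (∀ (a : S) (U : Set S), a ∈ U → cov a U) ∧
  (∀ (a : S) (U V : Set S), cov a U → covS cov U V → cov a V)

/-- the way-below relation `a ≪ b`. -/
def wb {S : Type*} (cov : S → Set S → Prop) (a b : S) : Prop :=
  ∀ U : Set S, cov b U → ∃ U₀ : Finset S, ↑U₀ ⊆ U ∧ cov a ↑U₀

/-- the way-below relation between subsets `U ≪ V`. -/
def wbS {S : Type*} (cov : S → Set S → Prop) (U V : Set S) : Prop :=
  ∀ W : Set S, covS cov V W → ∃ W₀ : Finset S, ↑W₀ ⊆ W ∧ covS cov U ↑W₀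

/-- A continuous basic cover, with the witnessing function `w`. -/
def IsContinuous {S : Type*} (cov : S → Set S → Prop) (w : S → Set S) : Prop :=
  (∀ a : S, ∀ b ∈ w a, wb cov b a) ∧ (∀ a : S, cov a (w a))

/-- splitting subsets. -/
def Splitting {S : Type*} (cov : S → Set S → Prop) (V : Set S) : Prop :=
  ∀ (a : S) (U : Set S), a ∈ V → cov a U → (V ∩ U).Nonempty

/-- located subsets. -/
def Located {S : Type*} (cov : S → Set S → Prop) (V : Set S) : Prop :=
  Splitting cov V ∧ ∀ a b : S, wb cov a b → a ∉ V ∨ b ∈ V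

/-- inverse image of a relation. -/
def rinv {α β : Type*} (r : α → β → Prop) (U : Set β) : Set α :=
  {x | ∃ a ∈ U, r x a}

/-- basic cover maps. -/
def IsBCM {α β : Type*} (cov : α → Set α → Prop) (cov' : β → Set β → Prop)
    (r : α → β → Prop) : Prop :=
  ∀ (a : β) (U : Set β), cov' a U → covS cov (rinv r {a}) (rinv r U)

/-- perfect maps. -/
def IsPerfect {α β : Type*} (cov : α → Set α → Prop) (cov' : β → Set β → Prop)
    (r : α → β → Prop) : Prop :=
  ∀ a b : β, wb cov' a b → wbS cov (rinv r {a}) (rinv r {b})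

/-- the terminal basic cover `1 = ({∗}, ∈)`. -/
def unitCov : Unit → Set Unit → Prop := fun x U => x ∈ U

/-! ### Formal topologies -/

/-- `U ↓ V` with respect to a preorder `le`. -/
def down {S : Type*} (le : S → S → Prop) (U V : Set S) : Set S :=
  {c | ∃ a ∈ U, ∃ b ∈ V, le c a ∧ le c b}

/-- A formal topology: a basic cover together with a compatible preorder. -/
def IsFormalTopology {S : Type*} (cov : S → Set S → Prop) (le : S → S → Prop) : Prop :=
  IsBasicCover cov ∧ Reflexive le ∧ Transitive le ∧
  (∀ a b : S, le a b → cov a {b}) ∧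
  (∀ (a : S) (U V : Set S), cov a U → cov a V → cov a (down le U V))

/-- formal topology maps. -/
def IsFTM {α β : Type*} (cov : α → Set α → Prop) (le : α → α → Prop)
    (cov' : β → Set β → Prop) (le' : β → β → Prop) (r : α → β → Prop) : Prop :=
  IsBCM cov cov' r ∧
  covS cov Set.univ (rinv r Set.univ) ∧
  ∀ a b : β, covS cov (down le (rinv r {a}) (rinv r {b})) (rinv r (down le' {a} {b}))

/-- the order on maps. -/
def MapLE {α β : Type*} (cov : α → Set α → Prop) (r s : α → β → Prop) : Prop :=
  ∀ a : β, covS cov (rinv r {a}) (rinv s {a})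

/-- equality of maps. -/
def MapEq {α β : Type*} (cov : α → Set α → Prop) (r s : α → β → Prop) : Prop :=
  MapLE cov r s ∧ MapLE cov s r

/-- composition of relational maps (`comp s r = s ∘ r`). -/
def comp {α β γ : Type*} (s : β → γ → Prop) (r : α → β → Prop) : α → γ → Prop :=
  fun x c => ∃ b, r x b ∧ s b c

/-- `b* = {c | c ↓ b ◁ ∅}`. -/
def star {S : Type*} (cov : S → Set S → Prop) (le : S → S → Prop) (b : S) : Set S :=
  {c | covS cov (down le {c} {b}) ∅}

/-- `b ⋘ a` iff `S ◁ b* ∪ {a}`. -/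
def wc {S : Type*} (cov : S → Set S → Prop) (le : S → S → Prop) (b a : S) : Prop :=
  covS cov Set.univ (star cov le b ∪ {a})

/-- regular formal topologies. -/
def Regular {S : Type*} (cov : S → Set S → Prop) (le : S → S → Prop) : Prop :=
  ∀ a : S, cov a {b | wc cov le b a}

/-- compactness: `S ≪ S`. -/
def Compact {S : Type*} (cov : S → Set S → Prop) : Prop :=
  wbS cov Set.univ Set.univ

/-- stability: `a ≪ a'` and `b ≪ b'` imply `a↓b ≪ a'↓b'`. -/
def Stable {S : Type*} (cov : S → Set S → Prop) (le : S → S → Prop) : Prop :=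
  ∀ a a' b b' : S, wb cov a a' → wb cov b b' →
    wbS cov (down le {a} {b}) (down le {a'} {b'})

/-- isomorphism of formal topologies. -/
def IsIso {α β : Type*} (cov : α → Set α → Prop) (le : α → α → Prop)
    (cov' : β → Set β → Prop) (le' : β → β → Prop) : Prop :=
  ∃ (r : α → β → Prop) (s : β → α → Prop),
    IsFTM cov le cov' le' r ∧ IsFTM cov' le' cov le s ∧
    MapEq cov (comp s r) (fun a b => a = b) ∧
    MapEq cov' (comp r s) (fun a b => a = b)

/-! ### Geometric theories and the covers they present -/

/-- the preorder `A ≤ B ↔ B ⊆ A` on finite sets of generators. -/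
def supord {P : Type*} : Finset P → Finset P → Prop := fun A B => B ⊆ A

/-- The cover on `Finset P` inductively generated by a geometric theory `T`
(an axiom `T A 𝒞` means `⋀A ⊢ ⋁_{B ∈ 𝒞} ⋀B`). -/
inductive GCov {P : Type*} (T : Finset P → Set (Finset P) → Prop) :
    Finset P → Set (Finset P) → Prop where
  | refl {A : Finset P} {𝒰 : Set (Finset P)} : A ∈ 𝒰 → GCov T A 𝒰
  | le {A B : Finset P} {𝒰 : Set (Finset P)} : B ⊆ A → GCov T B 𝒰 → GCov T A 𝒰
  | ax {A : Finset P} {𝒞 𝒰 : Set (Finset P)} (C : Finset P) :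
      T A 𝒞 → (∀ B ∈ 𝒞, GCov T (C ∪ B) 𝒰) → GCov T (C ∪ A) 𝒰

theorem GCov_trans {P : Type*} {T : Finset P → Set (Finset P) → Prop}
    {A : Finset P} {𝒰 𝒱 : Set (Finset P)}
    (h : GCov T A 𝒰) (h' : ∀ B ∈ 𝒰, GCov T B 𝒱) : GCov T A 𝒱 := by
  induction h with
  | refl hA => exact h' _ hA
  | le hBA _ ih => exact GCov.le hBA (ih h')
  | ax C hT _ ih => exact GCov.ax C hT (fun B hB => ih B hB h')

theorem GCov_isBasicCover {P : Type*} (T : Finset P → Set (Finset P) → Prop) :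
    IsBasicCover (GCov T) :=
  ⟨fun _ _ h => GCov.refl h, fun _ _ _ h h' => GCov_trans h h'⟩

/-! ### The patch, Lawson and lower powerlocale theories -/

/-- generators of the patch/Lawson theories : `r a` and `l A`. -/
inductive PatchGen (S : Type u) : Type u where
  | r : S → PatchGen S
  | l : Finset S → PatchGen S

/-- The geometric theory `T_P` presenting the patch of a stably locally compact
formal topology. -/
inductive PatchThy {S : Type*} (cov : S → Set S → Prop) (le : S → S → Prop) :
    Finset (PatchGen S) → Set (Finset (PatchGen S)) → Prop where
  | R1 : PatchThy cov le ∅ {B | ∃ a : S, B = {PatchGen.r a}}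
  | R2 (a b : S) :
      PatchThy cov le {PatchGen.r a, PatchGen.r b}
        {B | ∃ c ∈ down le {a} {b}, B = {PatchGen.r c}}
  | R3 (a : S) (A : Finset S) :
      cov a ↑A → PatchThy cov le {PatchGen.r a} {B | ∃ b ∈ A, B = {PatchGen.r b}}
  | R4 (a : S) :
      PatchThy cov le {PatchGen.r a} {B | ∃ b : S, wb cov b a ∧ B = {PatchGen.r b}}
  | L1 : PatchThy cov le ∅ {({PatchGen.l ∅} : Finset (PatchGen S))}
  | L2 (A B : Finset S) :
      covS cov ↑A ↑B →
      PatchThy cov le {PatchGen.l B} {({PatchGen.l A} : Finset (PatchGen S))}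
  | L3 (A B : Finset S) :
      PatchThy cov le {PatchGen.l A, PatchGen.l B}
        {D | ∃ C : Finset S, wbS cov ↑A ↑C ∧ wbS cov ↑B ↑C ∧ D = {PatchGen.l C}}
  | Loc (a b : S) :
      wb cov a b →
      PatchThy cov le ∅
        {({PatchGen.l {a}} : Finset (PatchGen S)), ({PatchGen.r b} : Finset (PatchGen S))}
  | D (a : S) :
      PatchThy cov le {PatchGen.l {a}, PatchGen.r a} (∅ : Set (Finset (PatchGen S)))

/-- the cover of `Patch(S)`. -/
def patchCov {S : Type*} (cov : S → Set S → Prop) (le : S → S → Prop) :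
    Finset (PatchGen S) → Set (Finset (PatchGen S)) → Prop :=
  GCov (PatchThy cov le)

/-- the counit `ε_P : Patch(S) → S`. -/
def epsP {S : Type*} (cov : S → Set S → Prop) (le : S → S → Prop) :
    Finset (PatchGen S) → S → Prop :=
  fun 𝔄 a => patchCov cov le 𝔄 {({PatchGen.r a} : Finset (PatchGen S))}

/-- The geometric theory `T_L` presenting the Lawson topology of a continuous
basic cover (the axioms of `T_P` without (R1), (R2)). -/
inductive LawsonThy {S : Type*} (cov : S → Set S → Prop) :
    Finset (PatchGen S) → Set (Finset (PatchGen S)) → Prop where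
  | R3 (a : S) (A : Finset S) :
      cov a ↑A → LawsonThy cov {PatchGen.r a} {B | ∃ b ∈ A, B = {PatchGen.r b}}
  | R4 (a : S) :
      LawsonThy cov {PatchGen.r a} {B | ∃ b : S, wb cov b a ∧ B = {PatchGen.r b}}
  | L1 : LawsonThy cov ∅ {({PatchGen.l ∅} : Finset (PatchGen S))}
  | L2 (A B : Finset S) :
      covS cov ↑A ↑B →
      LawsonThy cov {PatchGen.l B} {({PatchGen.l A} : Finset (PatchGen S))}
  | L3 (A B : Finset S) :
      LawsonThy cov {PatchGen.l A, PatchGen.l B}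
        {D | ∃ C : Finset S, wbS cov ↑A ↑C ∧ wbS cov ↑B ↑C ∧ D = {PatchGen.l C}}
  | Loc (a b : S) :
      wb cov a b →
      LawsonThy cov ∅
        {({PatchGen.l {a}} : Finset (PatchGen S)), ({PatchGen.r b} : Finset (PatchGen S))}
  | D (a : S) :
      LawsonThy cov {PatchGen.l {a}, PatchGen.r a} (∅ : Set (Finset (PatchGen S)))

/-- the cover of the Lawson topology `L(S)`. -/
def lawsonCov {S : Type*} (cov : S → Set S → Prop) :
    Finset (PatchGen S) → Set (Finset (PatchGen S)) → Prop :=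
  GCov (LawsonThy cov)

/-- the counit `ε_L : L(S) → S`. -/
def epsL {S : Type*} (cov : S → Set S → Prop) : Finset (PatchGen S) → S → Prop :=
  fun 𝔄 a => lawsonCov cov 𝔄 {({PatchGen.r a} : Finset (PatchGen S))}

/-- The theory presenting the lower powerlocale of a continuous basic cover:
generators `a ∈ S`, axioms (R3) and (R4). -/
inductive LowerThy {S : Type*} (cov : S → Set S → Prop) :
    Finset S → Set (Finset S) → Prop where
  | R3 (a : S) (A : Finset S) :
      cov a ↑A → LowerThy cov {a} {B | ∃ b ∈ A, B = ({b} : Finset S)}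
  | R4 (a : S) :
      LowerThy cov {a} {B | ∃ b : S, wb cov b a ∧ B = ({b} : Finset S)}

/-- the cover of the lower powerlocale `Lower(S)`. -/
def lowerCov {S : Type*} (cov : S → Set S → Prop) :
    Finset S → Set (Finset S) → Prop :=
  GCov (LowerThy cov)

/-- the counit `σ_L : Lower(S) → S`. -/
def sigmaL {S : Type*} (cov : S → Set S → Prop) : Finset S → S → Prop :=
  fun A a => lowerCov cov A ({({a} : Finset S)} : Set (Finset S))

/-! ### de Groot duals -/

/-- `↟A = {B ∈ Fin S | A ≪ B}`. -/
def upF {S : Type*} (cov : S → Set S → Prop) (A : Finset S) : Set (Finset S) :=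
  {B | wbS cov ↑A ↑B}

/-- the finite join `⋁^F {↟A | A ∈ 𝒜}` of Scott open filters. -/
def finJoin {S : Type*} (cov : S → Set S → Prop) (le : S → S → Prop)
    (𝒜 : Finset (Finset S)) : Set (Finset S) :=
  if 𝒜 = ∅ then {B | covS cov Set.univ ↑B}
  else {B | ∃ g : Finset S → Finset S,
    (∀ A ∈ 𝒜, wbS cov ↑A ↑(g A)) ∧
    wbS cov {c | ∀ A ∈ 𝒜, ∃ b ∈ g A, le c b} ↑B}

/-- The cover `◁^D` of the de Groot dual `S^D`, inductively generated on
`(Fin S, ⊇)` by the axioms (D3) `A ◁ ↟A` and (D4). -/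
inductive DCov {S : Type*} (cov : S → Set S → Prop) (le : S → S → Prop) :
    Finset S → Set (Finset S) → Prop where
  | refl {A : Finset S} {𝒰 : Set (Finset S)} : A ∈ 𝒰 → DCov cov le A 𝒰
  | le {A B : Finset S} {𝒰 : Set (Finset S)} :
      B ⊆ A → DCov cov le B 𝒰 → DCov cov le A 𝒰
  | d3 {A A' : Finset S} {𝒰 : Set (Finset S)} :
      A ⊆ A' →
      (∀ C : Finset S, A' ⊆ C → (∃ B : Finset S, wbS cov ↑A ↑B ∧ B ⊆ C) →
        DCov cov le C 𝒰) →
      DCov cov le A' 𝒰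
  | d4 {A A' : Finset S} {𝒜 : Finset (Finset S)} {𝒰 : Set (Finset S)} :
      A ⊆ A' → upF cov A ⊆ finJoin cov le 𝒜 →
      (∀ C : Finset S, A' ⊆ C → (∃ B ∈ 𝒜, B ⊆ C) → DCov cov le C 𝒰) →
      DCov cov le A' 𝒰

/-- the cover of the Scott topology `Σ(S)` on `(Fin S, ⊇)`. -/
def scottCov {S : Type*} (cov : S → Set S → Prop) :
    Finset S → Set (Finset S) → Prop :=
  fun A 𝒰 => upF cov A ⊆ ⋃ B ∈ 𝒰, upF cov B

/-- a filter (with respect to `◁`) of basic opens, given by a set of finite subsets. -/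
def IsCovFilter {S : Type*} (cov : S → Set S → Prop) (le : S → S → Prop)
    (𝒱 : Set (Finset S)) : Prop :=
  𝒱.Nonempty ∧
  (∀ A ∈ 𝒱, ∀ B : Finset S, covS cov ↑A ↑B → B ∈ 𝒱) ∧
  (∀ A ∈ 𝒱, ∀ B ∈ 𝒱, ∃ C ∈ 𝒱, covS cov ↑C (down le ↑A ↑B))

/-- The geometric theory `T^d` presenting the de Groot dual `S^d`:
generators `l A` (identified with `A : Finset S`), axioms (L1)–(L3) and (D4). -/
inductive DGThy {S : Type*} (cov : S → Set S → Prop) (le : S → S → Prop) :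
    Finset (Finset S) → Set (Finset (Finset S)) → Prop where
  | L1 : DGThy cov le ∅ {({(∅ : Finset S)} : Finset (Finset S))}
  | L2 (A B : Finset S) :
      covS cov ↑A ↑B → DGThy cov le {B} {({A} : Finset (Finset S))}
  | L3 (A B : Finset S) :
      DGThy cov le {A, B}
        {D | ∃ C : Finset S, wbS cov ↑A ↑C ∧ wbS cov ↑B ↑C ∧ D = ({C} : Finset (Finset S))}
  | D4 (A : Finset S) (𝒜 : Finset (Finset S)) :
      upF cov A ⊆ finJoin cov le 𝒜 →
      DGThy cov le {A} {D | ∃ B ∈ 𝒜, D = ({B} : Finset (Finset S))}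

/-! ### Spectral formal topologies -/

/-- spectral formal topologies: a compatible meet-semilattice structure on the
base, with every basic element way-below itself. -/
def IsSpectral {S : Type*} (cov : S → Set S → Prop) (le : S → S → Prop)
    (one : S) (meet : S → S → S) : Prop :=
  (∀ a : S, cov a {one}) ∧
  (∀ a b : S, cov (meet a b) (down le {a} {b})) ∧
  (∀ a b : S, ∀ c ∈ down le {a} {b}, cov c {meet a b}) ∧
  (∀ a : S, wb cov a a)

/-! ### Subtopologies -/

/-- the property of being a formal-topology cover compatible with `le`. -/
def IsFTCover {S : Type*} (cov : S → Set S → Prop) (le : S → S → Prop) : Prop :=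
  IsBasicCover cov ∧ (∀ a b : S, le a b → cov a {b}) ∧
  (∀ (a : S) (U V : Set S), cov a U → cov a V → cov a (down le U V))

/-- The meet (in `SubTop(S)`) of a family of subtopology covers: the least
formal-topology cover containing all of them. -/
def covMeet {S : Type*} {ι : Sort*} (le : S → S → Prop)
    (F : ι → (S → Set S → Prop)) : S → Set S → Prop :=
  fun a U => ∀ c : S → Set S → Prop,
    IsFTCover c le → (∀ i : ι, ∀ (a' : S) (U' : Set S), F i a' U' → c a' U') → c a U

/-- the closed subtopology `C_a` determined by `{a}`. -/
def closedCov {S : Type*} (cov : S → Set S → Prop) (a : S) : S → Set S → Prop :=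
  fun c V => cov c ({a} ∪ V)

/-- the open subtopology `S_B` determined by a finite `B`. -/
def openCov {S : Type*} (cov : S → Set S → Prop) (le : S → S → Prop)
    (B : Finset S) : S → Set S → Prop :=
  fun c V => covS cov (down le {c} ↑B) V

/-- `K_A = ⋀_{A ≪ B} S_B`. -/
def KCov {S : Type*} (cov : S → Set S → Prop) (le : S → S → Prop) (A : Finset S) :
    S → Set S → Prop :=
  covMeet le (fun B : {B : Finset S // wbS cov ↑A ↑B} => openCov cov le B.1)

/-- `C_a ∨ K_A` (the join of subtopologies is the intersection of covers). -/
def CKCov {S : Type*} (cov : S → Set S → Prop) (le : S → S → Prop)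
    (a : S) (A : Finset S) : S → Set S → Prop :=
  fun c V => closedCov cov a c V ∧ KCov cov le A c V

/-- perfect subtopologies. -/
def IsPerfectSub {S : Type*} (cov : S → Set S → Prop) (le : S → S → Prop)
    (cov' : S → Set S → Prop) : Prop :=
  IsFTCover cov' le ∧ (∀ (a : S) (U : Set S), cov a U → cov' a U) ∧
  (∀ a b : S, wb cov a b → wb cov' a b)

/-- the order of `PSub(S)`: `(a,A) ≤ (b,B)` iff `C_b ∨ K_B ⊑ C_a ∨ K_A`. -/
def PSubLe {S : Type*} (cov : S → Set S → Prop) (le : S → S → Prop) :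
    S × Finset S → S × Finset S → Prop :=
  fun p q => ∀ (c : S) (V : Set S), CKCov cov le p.1 p.2 c V → CKCov cov le q.1 q.2 c V

/-- the cover of `PSub(S)`: `(a,A) ◁ U` iff `⋀{C_b ∨ K_B | (b,B) ∈ U} ⊑ C_a ∨ K_A`. -/
def covPSub {S : Type*} (cov : S → Set S → Prop) (le : S → S → Prop) :
    S × Finset S → Set (S × Finset S) → Prop :=
  fun p U => ∀ (c : S) (V : Set S), CKCov cov le p.1 p.2 c V →
    covMeet le (fun q : U => CKCov cov le q.1.1 q.1.2) c V

/-- the map `r : PSub(S) → Patch(S)` on generators. -/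
def rGenPS {S : Type*} (cov : S → Set S → Prop) (le : S → S → Prop)
    (p : S × Finset S) : PatchGen S → Prop
  | PatchGen.r b => covPSub cov le p {((b, (∅ : Finset S)) : S × Finset S)}
  | PatchGen.l B => covPSub cov le p {q : S × Finset S | q.2 = B}

/-- the map `r : PSub(S) → Patch(S)`, extended along the presentation. -/
def rPS {S : Type*} (cov : S → Set S → Prop) (le : S → S → Prop) :
    S × Finset S → Finset (PatchGen S) → Prop :=
  fun p 𝔅 => ∀ g ∈ 𝔅, covPSub cov le p (rinv (fun q g' => rGenPS cov le q g') {g})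

/-- the map `s : Patch(S) → PSub(S)`. -/
def sPS {S : Type*} (cov : S → Set S → Prop) (le : S → S → Prop) :
    Finset (PatchGen S) → (S × Finset S) → Prop :=
  fun 𝔄 p => patchCov cov le 𝔄
    ({({PatchGen.r p.1, PatchGen.l p.2} : Finset (PatchGen S))} : Set (Finset (PatchGen S)))

/-! ### Saturated subsets, dcpos and preframes -/

/-- the saturated subsets of a basic cover. -/
abbrev SatSet {α : Type*} (cov : α → Set α → Prop) : Type _ :=
  {U : Set α // ∀ a, cov a U → a ∈ U}

/-- the join of a family of saturated subsets. -/
def satSup {α : Type*} {cov : α → Set α → Prop} (hbc : IsBasicCover cov)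
    (D : Set (SatSet cov)) : SatSet cov :=
  ⟨{a | cov a (⋃ U ∈ D, (U : Set α))}, fun a h => hbc.2 a _ _ h (fun _ hb => hb)⟩

/-- inductively generated basic covers: `BGen Ax` is the cover generated by the
axiom-set with axioms `a ◁ C` for `C ∈ Ax a`. -/
inductive BGen {S : Type*} (Ax : S → Set (Set S)) : S → Set S → Prop where
  | refl {a : S} {U : Set S} : a ∈ U → BGen Ax a U
  | infty {a : S} {U : Set S} (C : Set S) :
      C ∈ Ax a → (∀ b ∈ C, BGen Ax b U) → BGen Ax a U

theorem BGen_trans {S : Type*} {Ax : S → Set (Set S)} {a : S} {U V : Set S}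
    (h : BGen Ax a U) (h' : ∀ b ∈ U, BGen Ax b V) : BGen Ax a V := by
  induction h with
  | refl ha => exact h' _ ha
  | infty C hC _ ih => exact BGen.infty C hC (fun b hb => ih b hb h')

theorem BGen_isBasicCover {S : Type*} (Ax : S → Set (Set S)) :
    IsBasicCover (BGen Ax) :=
  ⟨fun _ _ h => BGen.refl h, fun _ _ _ h h' => BGen_trans h h'⟩

/-- the lower powerlocale theory of an inductively generated basic cover. -/
inductive LowerThyAx {S : Type*} (Ax : S → Set (Set S)) :
    Finset S → Set (Finset S) → Prop where
  | mk (a : S) (C : Set S) :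
      C ∈ Ax a → LowerThyAx Ax {a} {B | ∃ b ∈ C, B = ({b} : Finset S)}

/-- the counit `σ_L : Lower(S) → S` for an inductively generated basic cover. -/
def sigmaLAx {S : Type*} (Ax : S → Set (Set S)) : Finset S → S → Prop :=
  fun A a => GCov (LowerThyAx Ax) A ({({a} : Finset S)} : Set (Finset S))

/-- the top saturated subset of a presented topology. -/
def satTop {P : Type*} (T : Finset P → Set (Finset P) → Prop) : SatSet (GCov T) :=
  ⟨Set.univ, fun _ _ => Set.mem_univ _⟩

/-- binary meets of saturated subsets of a presented topology. -/
def satInfL {P : Type*} (T : Finset P → Set (Finset P) → Prop)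
    (U V : SatSet (GCov T)) : SatSet (GCov T) :=
  ⟨{A | GCov T A (down supord (U : Set (Finset P)) (V : Set (Finset P)))},
   fun _ h => GCov_trans h (fun _ hB => hB)⟩

/-- the suplattice homomorphism `σ_L* : Sat(S) → Sat(Lower(S))`. -/
def sigmaStar {S : Type*} (Ax : S → Set (Set S)) (U : SatSet (BGen Ax)) :
    SatSet (GCov (LowerThyAx Ax)) :=
  ⟨{A : Finset S | GCov (LowerThyAx Ax) A (rinv (sigmaLAx Ax) (U : Set S))},
   fun _ h => GCov_trans h (fun _ hB => hB)⟩

/-- a preframe structure on a partial order: finite meets and directed joins,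
with finite meets distributing over directed joins. -/
structure PreframeStr (X : Type*) [PartialOrder X] where
  top : X
  inf : X → X → X
  dSup : Set X → X
  le_top : ∀ x, x ≤ top
  inf_le_left : ∀ x y, inf x y ≤ x
  inf_le_right : ∀ x y, inf x y ≤ y
  le_inf : ∀ x y z, x ≤ y → x ≤ z → x ≤ inf y z
  le_dSup : ∀ d : Set X, d.Nonempty → DirectedOn (· ≤ ·) d → ∀ x ∈ d, x ≤ dSup d
  dSup_le : ∀ d : Set X, d.Nonempty → DirectedOn (· ≤ ·) d →
    ∀ z, (∀ x ∈ d, x ≤ z) → dSup d ≤ z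
  distrib : ∀ (x : X) (d : Set X), d.Nonempty → DirectedOn (· ≤ ·) d →
    inf x (dSup d) = dSup ((fun y => inf x y) '' d)

/-- dcpo homomorphisms out of `Sat(S)`. -/
def IsDcpoHom {α : Type*} {cov : α → Set α → Prop} (hbc : IsBasicCover cov)
    {X : Type*} [PartialOrder X] (PF : PreframeStr X) (f : SatSet cov → X) : Prop :=
  Monotone f ∧
  ∀ D : Set (SatSet cov), D.Nonempty → DirectedOn (· ≤ ·) D →
    f (satSup hbc D) = PF.dSup (f '' D)

/-- preframe homomorphisms out of the frame of a presented topology. -/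
def IsPreframeHomL {P : Type*} (T : Finset P → Set (Finset P) → Prop)
    {X : Type*} [PartialOrder X] (PF : PreframeStr X)
    (F : SatSet (GCov T) → X) : Prop :=
  Monotone F ∧ F (satTop T) = PF.top ∧
  (∀ U V, F (satInfL T U V) = PF.inf (F U) (F V)) ∧
  ∀ D : Set (SatSet (GCov T)), D.Nonempty → DirectedOn (· ≤ ·) D →
    F (satSup (GCov_isBasicCover T) D) = PF.dSup (F '' D)

/-! ### Located subsets: auxiliary notions -/

/-- the lower part `L_V` associated to a located subset `V`. -/
def LV {S : Type*} (cov : S → Set S → Prop) (V : Set S) : Set S :=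
  {a | ∃ A : Finset S, wbS cov {a} ↑A ∧ (↑A ∩ V : Set S) = ∅}

/-- cuts of a continuous basic cover. -/
def IsCut {S : Type*} (cov : S → Set S → Prop) (L U : Set S) : Prop :=
  (∀ (a : S) (A : Finset S), cov a ↑A → a ∈ U → ((↑A : Set S) ∩ U).Nonempty) ∧
  (∀ a ∈ U, ∃ b : S, wb cov b a ∧ b ∈ U) ∧
  (∀ (a : S) (A : Finset S), cov a ↑A → (↑A : Set S) ⊆ L → a ∈ L) ∧
  (∀ a ∈ L, ∃ A : Finset S, wbS cov {a} ↑A ∧ (↑A : Set S) ⊆ L) ∧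
  (∀ a b : S, wb cov a b → a ∈ L ∨ b ∈ U) ∧
  L ∩ U = ∅

end FTP

namespace FTP

theorem IsBasicCover.mono {S : Type*} {cov : S → Set S → Prop} (h : IsBasicCover cov)
    {a : S} {U V : Set S} (ha : cov a U) (hUV : U ⊆ V) : cov a V :=
  h.2 a U V ha fun b hb => h.1 b V (hUV hb)

theorem IsBCM.covS_rinv {α β : Type*} {cov : α → Set α → Prop} {cov' : β → Set β → Prop}
    {r : α → β → Prop} (h : IsBCM cov cov' r) {U V : Set β} (hUV : covS cov' U V) :
    covS cov (rinv r U) (rinv r V) := by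
  rintro x ⟨a, ha, hx⟩
  exact h a V (hUV a ha) x ⟨a, rfl, hx⟩

/-- A perfect map into a continuous basic cover is cobounded. -/
theorem IsPerfect.cobounded {α β : Type*} {cov : α → Set α → Prop} {cov' : β → Set β → Prop}
    {r : α → β → Prop} (hc : IsBasicCover cov) (hc' : IsBasicCover cov')
    {w' : β → Set β} (hw' : IsContinuous cov' w') (hr : IsBCM cov cov' r)
    (hp : IsPerfect cov cov' r) {U : Set β} (hU : wbS cov' U Set.univ) :
    wbS cov (rinv r U) Set.univ := by
  intro W hW
  obtain ⟨C, hC, hUC⟩ := hU {c | ∃ d, wb cov' c d} fun d _ =>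
    hc'.mono (hw'.2 d) fun c hcd => ⟨d, hw'.1 d c hcd⟩
  have hfin : ∀ c ∈ C, ∃ F : Finset α, ↑F ⊆ W ∧ covS cov (rinv r {c}) ↑F := by
    intro c hcC
    obtain ⟨d, hcd⟩ := hC hcC
    exact hp c d hcd W fun x _ => hW x trivial
  choose! f hfW hf using hfin
  refine ⟨C.biUnion f, ?_, fun x hx => ?_⟩
  · intro x hx
    obtain ⟨c, hcC, hxc⟩ := Finset.mem_biUnion.1 hx
    exact hfW c hcC hxc
  · refine hc.2 x _ _ (hr.covS_rinv hUC x hx) ?_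
    rintro y ⟨c, hcC, hy⟩
    exact hc.mono (hf c hcC y ⟨c, rfl, hy⟩) fun z hz => Finset.mem_biUnion.2 ⟨c, hcC, hz⟩

/-- Inverse images along a formal topology map preserve disjointness. -/
theorem IsFTM.cov_empty_of_mem_star {α β : Type*}
    {cov : α → Set α → Prop} {le : α → α → Prop} {cov' : β → Set β → Prop}
    {le' : β → β → Prop} {r : α → β → Prop} (hc : IsBasicCover cov)
    (hr : IsFTM cov le cov' le' r) {c d : β} (hd : d ∈ star cov' le' c) {e : α}
    (he : e ∈ down le (rinv r {d}) (rinv r {c})) : cov e ∅ := by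
  refine hc.2 e _ _ (hr.2.2 d c e he) fun x hx => ?_
  refine hc.mono (hr.1.covS_rinv hd x hx) ?_
  rintro y ⟨b, hb, -⟩
  exact hb

/-- A cobounded formal topology map into a regular formal topology is perfect. -/
theorem IsFTM.isPerfect_of_cobounded {α β : Type*}
    {cov : α → Set α → Prop} {le : α → α → Prop} {cov' : β → Set β → Prop}
    {le' : β → β → Prop} {r : α → β → Prop} (hft : IsFormalTopology cov le)
    (hreg' : Regular cov' le') (hr : IsFTM cov le cov' le' r)
    (hcob : ∀ U : Set β, wbS cov' U Set.univ → wbS cov (rinv r U) Set.univ) :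
    IsPerfect cov cov' r := by
  obtain ⟨hc, hrefl, -, hle, hdown⟩ := hft
  intro a b hab W hW
  have haW : wbS cov (rinv r {a}) Set.univ := by
    refine hcob {a} fun V hV => ?_
    obtain ⟨V₀, hV₀, haV₀⟩ := hab V (hV b trivial)
    refine ⟨V₀, hV₀, ?_⟩
    rintro _ rfl
    exact haV₀
  obtain ⟨C, hC, haC⟩ := hab _ (hreg' b)
  have hfin : ∀ c ∈ C, ∃ F : Finset α, ↑F ⊆ rinv r (star cov' le' c) ∪ W ∧
      covS cov (rinv r {a}) ↑F := by
    intro c hcC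
    refine haW _ fun x _ => ?_
    refine hc.2 x _ _ (hr.2.1 x trivial) fun y hy => ?_
    refine hc.2 y _ _ (hr.1.covS_rinv (hC hcC) y hy) ?_
    rintro z ⟨d, hd | hd, hz⟩
    · exact hc.1 z _ (Or.inl ⟨d, hd, hz⟩)
    · exact hc.mono (hW z ⟨d, hd, hz⟩) Set.subset_union_right
  choose! f hfW hf using hfin
  refine ⟨(C.biUnion f).filter (· ∈ W), fun x hx => (Finset.mem_filter.1 hx).2, ?_⟩
  intro x hx
  refine hc.2 x _ _ (hdown x _ _ (hr.1 a C haC x hx) (hc.1 x {x} rfl)) ?_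
  rintro y ⟨z, ⟨c, hcC, hz⟩, _, rfl, hyz, hyx⟩
  have hy : cov y ↑(f c) := hc.2 y _ _ (hle _ _ hyx) (by rintro _ rfl; exact hf c hcC _ hx)
  refine hc.2 y _ _ (hdown y _ _ hy (hle _ _ hyz)) ?_
  rintro e ⟨v, hv, _, rfl, hev, hez⟩
  rcases hfW c hcC hv with ⟨d, hd, hvd⟩ | hvW
  · exact hc.mono (hr.cov_empty_of_mem_star hc hd ⟨v, ⟨d, rfl, hvd⟩, _, ⟨c, rfl, hz⟩, hev, hez⟩)
      (Set.empty_subset _)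
  · refine hc.mono (hle _ _ hev) ?_
    rintro _ rfl
    exact Finset.mem_filter.2 ⟨Finset.mem_biUnion.2 ⟨c, hcC, hv⟩, hvW⟩

/-- A formal topology map between locally compact regular formal
topologies is perfect iff it is cobounded. -/
theorem perfect_iff_cobounded {S S' : Type u}
    (cov : S → Set S → Prop) (le : S → S → Prop)
    (cov' : S' → Set S' → Prop) (le' : S' → S' → Prop)
    (hft : IsFormalTopology cov le) (hft' : IsFormalTopology cov' le')
    (w : S → Set S) (hw : IsContinuous cov w)
    (w' : S' → Set S') (hw' : IsContinuous cov' w')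
    (hreg : Regular cov le) (hreg' : Regular cov' le')
    (r : S → S' → Prop) (hr : IsFTM cov le cov' le' r) :
    IsPerfect cov cov' r ↔
      ∀ U : Set S', wbS cov' U Set.univ → wbS cov (rinv r U) Set.univ := by
  exact ⟨fun hp _ hU => hp.cobounded hft.1 hft'.1 hw' hr.1 hU,
    hr.isPerfect_of_cobounded hft hreg'⟩

end FTP
end
end

section
/- For every stably locally compact formal topology S, the patch Patch(S) — the formal topology presented by the geometric theory T_P — is a locally compact regular formal topology. -/
noncomputable section
open Classical

universe u v

namespace FTP

/-! ### The way-below relation in a continuous basic cover -/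

section WayBelow

variable {S : Type*} {cov : S → Set S → Prop}

theorem wbS_singleton {a b : S} : wbS cov {a} {b} ↔ wb cov a b := by
  simp [wbS, wb, covS]

theorem covS_refl (hbc : IsBasicCover cov) (A : Set S) : covS cov A A :=
  fun a ha => hbc.1 a A ha

theorem covS_of_subset (hbc : IsBasicCover cov) {A B : Set S} (h : A ⊆ B) : covS cov A B :=
  fun a ha => hbc.1 a B (h ha)

theorem covS_trans (hbc : IsBasicCover cov) {A B C : Set S}
    (h : covS cov A B) (h' : covS cov B C) : covS cov A C :=
  fun a ha => hbc.2 a B C (h a ha) h'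

theorem covS_of_wbS (hbc : IsBasicCover cov) {A B : Set S} (h : wbS cov A B) :
    covS cov A B := by
  obtain ⟨W, hW, hA⟩ := h B (covS_refl hbc B)
  exact covS_trans hbc hA (covS_of_subset hbc hW)

theorem wbS_of_covS_of_wbS (hbc : IsBasicCover cov) {A B C : Set S}
    (h : covS cov A B) (h' : wbS cov B C) : wbS cov A C := by
  intro W hW
  obtain ⟨W₀, h₀, h₁⟩ := h' W hW
  exact ⟨W₀, h₀, covS_trans hbc h h₁⟩

theorem wbS_of_wbS_of_covS (hbc : IsBasicCover cov) {A B C : Set S}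
    (h : wbS cov A B) (h' : covS cov B C) : wbS cov A C :=
  fun W hW => h W (covS_trans hbc h' hW)

theorem wbS_union (hbc : IsBasicCover cov) {A B C : Set S}
    (hA : wbS cov A C) (hB : wbS cov B C) : wbS cov (A ∪ B) C := by
  intro W hW
  obtain ⟨W₁, h₁, h₁'⟩ := hA W hW
  obtain ⟨W₂, h₂, h₂'⟩ := hB W hW
  refine ⟨W₁ ∪ W₂, by simp [h₁, h₂], ?_⟩
  rintro x (hx | hx)
  · exact covS_trans hbc h₁' (covS_of_subset hbc (by simp)) x hx
  · exact covS_trans hbc h₂' (covS_of_subset hbc (by simp)) x hx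

theorem wbS_of_forall_exists_wb (hbc : IsBasicCover cov) (A : Finset S) {D : Set S}
    (h : ∀ a ∈ A, ∃ d ∈ D, wb cov a d) : wbS cov ↑A D := by
  induction A using Finset.induction with
  | empty => exact fun W _ => ⟨∅, by simp, by simp [covS]⟩
  | insert a A _ ih =>
    rw [Finset.coe_insert, Set.insert_eq]
    refine wbS_union hbc ?_ (ih fun a' ha' => h a' (Finset.mem_insert_of_mem ha'))
    obtain ⟨d, hd, had⟩ := h a (Finset.mem_insert_self a A)
    exact wbS_of_wbS_of_covS hbc (wbS_singleton.2 had)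
      (covS_of_subset hbc (Set.singleton_subset_iff.2 hd))

/-- In a continuous basic cover `A ≪ B` interpolates through a finite set whose elements
are each way-below some element of `B`. -/
theorem exists_wbS_interpolant (hbc : IsBasicCover cov) {w : S → Set S}
    (hw : IsContinuous cov w) {A B : Set S} (h : wbS cov A B) :
    ∃ D : Finset S, wbS cov A ↑D ∧ ∀ d ∈ D, ∃ b ∈ B, wb cov d b := by
  have hB : covS cov B {x | ∃ d, wb cov x d ∧ ∃ b ∈ B, wb cov d b} := fun b hb =>
    hbc.2 b _ _ (hw.2 b) fun d hd => hbc.2 d _ _ (hw.2 d) fun x hx =>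
      hbc.1 _ _ ⟨d, hw.1 d x hx, b, hb, hw.1 b d hd⟩
  obtain ⟨W, hW, hA⟩ := h _ hB
  have hW' : ∀ x ∈ W, ∃ d, wb cov x d ∧ ∃ b ∈ B, wb cov d b := fun x hx => hW hx
  choose! f hf hf' using hW'
  refine ⟨W.image f, wbS_of_covS_of_wbS hbc hA ?_, ?_⟩
  · exact wbS_of_forall_exists_wb hbc W fun x hx =>
      ⟨f x, by simpa using ⟨x, hx, rfl⟩, hf x hx⟩
  · intro d hd
    obtain ⟨x, hx, rfl⟩ := Finset.mem_image.1 hd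
    exact hf' x hx

end WayBelow

/-! ### Covers presented by geometric theories -/

section GCov

variable {P : Type*} {T : Finset P → Set (Finset P) → Prop}

theorem GCov_mono {A : Finset P} {𝒰 𝒱 : Set (Finset P)} (h : GCov T A 𝒰) (h' : 𝒰 ⊆ 𝒱) :
    GCov T A 𝒱 :=
  GCov_trans h fun _ hB => GCov.refl (h' hB)

theorem GCov_cut {A C : Finset P} {𝒰 𝒱 : Set (Finset P)} (h : GCov T A 𝒰)
    (h' : ∀ B ∈ 𝒰, GCov T (C ∪ B) 𝒱) : GCov T (C ∪ A) 𝒱 := by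
  induction h generalizing C with
  | refl hA => exact h' _ hA
  | le hBA _ ih => exact GCov.le (Finset.union_subset_union_right hBA) (ih h')
  | ax C₀ hT _ ih =>
    rw [← Finset.union_assoc]
    refine GCov.ax (C ∪ C₀) hT fun B hB => ?_
    rw [Finset.union_assoc]
    exact ih B hB h'

/-- A cover of a finite set of generators may be used to split any larger one. -/
theorem GCov_of_subset {A X : Finset P} {𝒰 𝒱 : Set (Finset P)} (h : GCov T A 𝒰)
    (hA : A ⊆ X) (h' : ∀ B ∈ 𝒰, GCov T (X ∪ B) 𝒱) : GCov T X 𝒱 := by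
  rw [← Finset.union_eq_left.2 hA]
  exact GCov_cut h h'

theorem GCov_ax {A X : Finset P} {𝒞 : Set (Finset P)} (h : T A 𝒞) (hA : A ⊆ X) :
    GCov T X 𝒞 := by
  rw [← Finset.union_eq_left.2 hA]
  exact GCov.ax X h fun B hB => GCov.le Finset.subset_union_right (GCov.refl hB)

theorem GCov_self {A : Finset P} : GCov T A {A} := GCov.refl rfl

theorem GCov_singleton {A B : Finset P} (h : B ⊆ A) : GCov T A {B} := GCov.le h GCov_self

/-- If each generator is covered by generators related to it, then each finite set of
generators is covered by the finite sets related to it. -/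
theorem GCov_refinements {R : P → P → Prop}
    (hR : ∀ g, GCov T {g} {B | ∃ g', R g' g ∧ B = {g'}}) (A : Finset P) :
    GCov T A {A' | ∀ g ∈ A, ∃ g' ∈ A', R g' g} := by
  induction A using Finset.induction with
  | empty => exact GCov.refl (by simp)
  | insert g A _ ih =>
    rw [Finset.insert_eq]
    refine GCov_cut ih fun B hB => ?_
    rw [Finset.union_comm]
    refine GCov_cut (hR g) ?_
    rintro _ ⟨g', hg', rfl⟩
    refine GCov.refl fun x hx => ?_
    rcases Finset.mem_union.1 hx with hx | hx
    · rw [Finset.mem_singleton] at hx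
      exact ⟨g', by simp, hx ▸ hg'⟩
    · obtain ⟨y, hy, hyx⟩ := hB x hx
      exact ⟨y, by simp [hy], hyx⟩

theorem GCov_union_singleton {X A : Finset P} {𝒱 : Set (Finset P)}
    (h : ∀ g ∈ A, GCov T ∅ (𝒱 ∪ {{g}})) : GCov T X (𝒱 ∪ {A}) := by
  induction A using Finset.induction with
  | empty => exact GCov_mono (GCov_singleton (Finset.empty_subset X)) (by simp)
  | insert g A _ ih =>
    refine GCov_trans (ih fun g' hg' => h g' (Finset.mem_insert_of_mem hg')) ?_
    rintro B (hB | rfl)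
    · exact GCov.refl (Or.inl hB)
    · refine GCov_of_subset (h g (Finset.mem_insert_self g B)) (Finset.empty_subset B) ?_
      rintro C (hC | rfl)
      · exact GCov.le Finset.subset_union_right (GCov.refl (Or.inl hC))
      · exact GCov.refl (Or.inr (by rw [Set.mem_singleton_iff, Finset.insert_eq, Finset.union_comm]))

/-- `X` is covered by finitely many members of `𝒰`. -/
def FinGCov (T : Finset P → Set (Finset P) → Prop) (X : Finset P) (𝒰 : Set (Finset P)) :
    Prop :=
  ∃ 𝒰₀ ⊆ 𝒰, 𝒰₀.Finite ∧ GCov T X 𝒰₀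

theorem FinGCov_of_subset {A X : Finset P} {𝒰 𝒱 : Set (Finset P)} (h : GCov T A 𝒱)
    (hA : A ⊆ X) (hfin : 𝒱.Finite) (h' : ∀ V ∈ 𝒱, FinGCov T (X ∪ V) 𝒰) :
    FinGCov T X 𝒰 := by
  choose! f hf hfin' hc using h'
  refine ⟨⋃ V ∈ 𝒱, f V, Set.iUnion₂_subset hf, hfin.biUnion hfin', ?_⟩
  exact GCov_of_subset h hA fun V hV =>
    GCov_mono (hc V hV) (Set.subset_biUnion_of_mem hV)

end GCov

/-! ### Derived rules of the patch theory -/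

section Patch

variable {S : Type u} {cov : S → Set S → Prop} {le : S → S → Prop}

theorem patchCov_r {a : S} {A : Finset S} {X : Finset (PatchGen S)} (h : cov a ↑A)
    (hX : PatchGen.r a ∈ X) :
    patchCov cov le X ((fun b => {PatchGen.r b}) '' (A : Set S)) :=
  GCov_mono (GCov_ax (PatchThy.R3 a A h) (by simpa using hX))
    (by rintro _ ⟨b, hb, rfl⟩; exact ⟨b, hb, rfl⟩)

theorem patchCov_l {A B : Finset S} {X : Finset (PatchGen S)} (h : covS cov ↑A ↑B)
    (hX : PatchGen.l B ∈ X) : patchCov cov le X {{PatchGen.l A}} :=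
  GCov_ax (PatchThy.L2 A B h) (by simpa using hX)

theorem patchCov_l_union (hbc : IsBasicCover cov) {A B : Finset S}
    {X : Finset (PatchGen S)} (hA : PatchGen.l A ∈ X) (hB : PatchGen.l B ∈ X) :
    patchCov cov le X {{PatchGen.l (A ∪ B)}} := by
  refine GCov_trans (GCov_ax (PatchThy.L3 A B) (by simp [Finset.insert_subset_iff, hA, hB])) ?_
  rintro _ ⟨C, hAC, hBC, rfl⟩
  refine patchCov_l (B := C) ?_ (by simp)
  rw [Finset.coe_union]
  exact covS_of_wbS hbc (wbS_union hbc hAC hBC)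

theorem patchCov_empty_of_mem (hbc : IsBasicCover cov) {a : S} {B : Finset S}
    {X : Finset (PatchGen S)} (h : cov a ↑B) (ha : PatchGen.r a ∈ X)
    (hB : PatchGen.l B ∈ X) : patchCov cov le X ∅ := by
  refine GCov_of_subset (patchCov_r h ha) subset_rfl ?_
  rintro _ ⟨b, hb, rfl⟩
  have hl : patchCov cov le (X ∪ {PatchGen.r b}) {{PatchGen.l {b}}} :=
    patchCov_l (B := B)
      (by rintro x hx
          rw [Finset.coe_singleton, Set.mem_singleton_iff] at hx
          exact hx ▸ hbc.1 _ _ hb)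
      (by simp [hB])
  refine GCov_of_subset hl subset_rfl ?_
  rintro _ rfl
  exact GCov_ax (PatchThy.D b) (by simp [Finset.insert_subset_iff])

/-- The locatedness axiom for finite sets. -/
theorem patchCov_loc (hbc : IsBasicCover cov) {D E : Finset S}
    (h : ∀ d ∈ D, ∃ e ∈ E, wb cov d e) (X : Finset (PatchGen S)) :
    patchCov cov le X (insert {PatchGen.l D} ((fun e => {PatchGen.r e}) '' (E : Set S))) := by
  induction D using Finset.induction generalizing X with
  | empty => exact GCov_mono (GCov_ax PatchThy.L1 (Finset.empty_subset X)) (by simp)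
  | insert d D _ ih =>
    obtain ⟨e, he, hde⟩ := h d (Finset.mem_insert_self d D)
    refine GCov_trans (ih (fun d' hd' => h d' (Finset.mem_insert_of_mem hd')) X) ?_
    rintro B (rfl | hB)
    · refine GCov_of_subset (GCov_ax (PatchThy.Loc d e hde) (Finset.empty_subset _))
        subset_rfl ?_
      rintro _ (rfl | rfl)
      · rw [Finset.insert_eq]
        exact GCov_mono (patchCov_l_union hbc (by simp) (by simp))
          (Set.singleton_subset_iff.2 (Set.mem_insert _ _))
      · exact GCov_mono (GCov_singleton Finset.subset_union_right)
          (Set.singleton_subset_iff.2 (Or.inr ⟨e, he, rfl⟩))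
    · exact GCov.refl (Or.inr hB)

/-- The rounding relation on the generators of the patch. -/
def genWB (cov : S → Set S → Prop) : PatchGen S → PatchGen S → Prop
  | PatchGen.r a', PatchGen.r a => wb cov a' a
  | PatchGen.l B, PatchGen.l A => wbS cov ↑A ↑B
  | _, _ => False

/-- Every generator in `B` is approximated by some generator in `V`. -/
def GenRefines (cov : S → Set S → Prop) (V B : Finset (PatchGen S)) : Prop :=
  ∀ g ∈ B, ∃ g' ∈ V, genWB cov g' g

theorem GenRefines_union {V V' B B' : Finset (PatchGen S)} (h : GenRefines cov V B)
    (h' : GenRefines cov V' B') : GenRefines cov (V ∪ V') (B ∪ B') := by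
  intro g hg
  rcases Finset.mem_union.1 hg with hg | hg
  · obtain ⟨g', hg', hgg⟩ := h g hg
    exact ⟨g', by simp [hg'], hgg⟩
  · obtain ⟨g', hg', hgg⟩ := h' g hg
    exact ⟨g', by simp [hg'], hgg⟩

theorem GenRefines_singleton {g g' : PatchGen S} (h : genWB cov g' g) :
    GenRefines cov {g'} {g} := by
  simpa [GenRefines] using h

theorem GenRefines.exists_r {V B : Finset (PatchGen S)} (h : GenRefines cov V B) {a : S}
    (ha : PatchGen.r a ∈ B) : ∃ a', PatchGen.r a' ∈ V ∧ wb cov a' a := by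
  obtain ⟨g', hg', hg⟩ := h _ ha
  cases g' with
  | r a' => exact ⟨a', hg', hg⟩
  | l C => exact hg.elim

theorem GenRefines.exists_l {V B : Finset (PatchGen S)} (h : GenRefines cov V B)
    {A : Finset S} (hA : PatchGen.l A ∈ B) :
    ∃ C : Finset S, PatchGen.l C ∈ V ∧ wbS cov ↑A ↑C := by
  obtain ⟨g', hg', hg⟩ := h _ hA
  cases g' with
  | r a' => exact hg.elim
  | l C => exact ⟨C, hg', hg⟩

theorem patchCov_singleton_of_genWB (hbc : IsBasicCover cov) {g g' : PatchGen S}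
    {X : Finset (PatchGen S)} (h : genWB cov g' g) (hX : g' ∈ X) :
    patchCov cov le X {{g}} := by
  match g, g', h with
  | PatchGen.r a, PatchGen.r a', h =>
    have ha : cov a' ↑({a} : Finset S) := by
      rw [Finset.coe_singleton]
      exact covS_of_wbS hbc (wbS_singleton.2 h) a' rfl
    simpa using patchCov_r (le := le) ha hX
  | PatchGen.l A, PatchGen.l B, h => exact patchCov_l (covS_of_wbS hbc h) hX

theorem patchCov_of_GenRefines (hbc : IsBasicCover cov) {V B : Finset (PatchGen S)}
    (h : GenRefines cov V B) : patchCov cov le V {B} := by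
  induction B using Finset.induction with
  | empty => exact GCov_singleton (Finset.empty_subset V)
  | insert g B _ ih =>
    obtain ⟨g', hg', hg⟩ := h g (Finset.mem_insert_self g B)
    refine GCov_of_subset (ih fun x hx => h x (Finset.mem_insert_of_mem hx)) subset_rfl ?_
    rintro _ rfl
    refine GCov_of_subset (patchCov_singleton_of_genWB hbc hg (X := _) (by simp [hg']))
      subset_rfl ?_
    rintro _ rfl
    refine GCov_singleton ?_
    intro x hx
    rcases Finset.mem_insert.1 hx with rfl | hx
    · simp
    · simp [hx]

theorem patchCov_genWB (g : PatchGen S) :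
    patchCov cov le {g} {B | ∃ g', genWB cov g' g ∧ B = {g'}} := by
  cases g with
  | r a =>
    refine GCov_mono (GCov_ax (PatchThy.R4 a) subset_rfl) ?_
    rintro _ ⟨b, hb, rfl⟩
    exact ⟨PatchGen.r b, hb, rfl⟩
  | l A =>
    refine GCov_mono (GCov_ax (PatchThy.L3 A A) (by simp)) ?_
    rintro _ ⟨C, hC, -, rfl⟩
    exact ⟨PatchGen.l C, hC, rfl⟩

theorem exists_finset_covS_wb (hbc : IsBasicCover cov) {w : S → Set S}
    (hw : IsContinuous cov w) {A B : Set S} (h : wbS cov A B) :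
    ∃ D : Finset S, covS cov A ↑D ∧ ∀ d ∈ D, ∃ b ∈ B, wb cov d b := by
  obtain ⟨D, hAD, hDB⟩ := exists_wbS_interpolant hbc hw h
  exact ⟨D, covS_of_wbS hbc hAD, hDB⟩

/-- A refinement of the premise of an axiom of the patch theory is covered by finitely many
refinements of its conclusions. -/
theorem exists_finite_refinement (hft : IsFormalTopology cov le) {w : S → Set S}
    (hw : IsContinuous cov w) (hst : Stable cov le)
    {A X : Finset (PatchGen S)} {𝒞 : Set (Finset (PatchGen S))} (hT : PatchThy cov le A 𝒞)
    (hr : ∃ c d, PatchGen.r c ∈ X ∧ wb cov c d) (hX : GenRefines cov X A) :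
    ∃ 𝒱 : Set (Finset (PatchGen S)), 𝒱.Finite ∧ patchCov cov le X 𝒱 ∧
      ∀ V ∈ 𝒱, ∃ B ∈ 𝒞, GenRefines cov V B := by
  have hbc := hft.1
  cases hT with
  | R1 =>
    obtain ⟨c, d, hc, hcd⟩ := hr
    refine ⟨{{PatchGen.r c}}, Set.finite_singleton _, GCov_singleton (by simpa using hc), ?_⟩
    rintro _ rfl
    exact ⟨_, ⟨d, rfl⟩, GenRefines_singleton hcd⟩
  | R2 a b =>
    obtain ⟨a', ha', haa⟩ := hX.exists_r (a := a) (by simp)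
    obtain ⟨b', hb', hbb⟩ := hX.exists_r (a := b) (by simp)
    obtain ⟨D, hD, hD'⟩ := exists_finset_covS_wb hbc hw (hst a' a b' b haa hbb)
    refine ⟨(fun d => {PatchGen.r d}) '' (D : Set S), D.finite_toSet.image _, ?_, ?_⟩
    · refine GCov_trans
        (GCov_ax (PatchThy.R2 a' b') (by simp [Finset.insert_subset_iff, ha', hb'])) ?_
      rintro _ ⟨c, hc, rfl⟩
      exact patchCov_r (hD c hc) (by simp)
    · rintro _ ⟨d, hd, rfl⟩
      obtain ⟨c, hc, hdc⟩ := hD' d hd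
      exact ⟨_, ⟨c, hc, rfl⟩, GenRefines_singleton hdc⟩
  | R3 a A hA =>
    obtain ⟨a', ha', haa⟩ := hX.exists_r (a := a) (by simp)
    have haA : wbS cov {a'} ↑A :=
      wbS_of_wbS_of_covS hbc (wbS_singleton.2 haa) (by rintro x rfl; exact hA)
    obtain ⟨D, hD, hD'⟩ := exists_finset_covS_wb hbc hw haA
    refine ⟨(fun d => {PatchGen.r d}) '' (D : Set S), D.finite_toSet.image _,
      patchCov_r (hD a' rfl) ha', ?_⟩
    rintro _ ⟨d, hd, rfl⟩
    obtain ⟨c, hc, hdc⟩ := hD' d hd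
    exact ⟨_, ⟨c, hc, rfl⟩, GenRefines_singleton hdc⟩
  | R4 a =>
    obtain ⟨a', ha', haa⟩ := hX.exists_r (a := a) (by simp)
    obtain ⟨E, hE, hE'⟩ := exists_wbS_interpolant hbc hw (wbS_singleton.2 haa)
    obtain ⟨D, hD, hD'⟩ := exists_finset_covS_wb hbc hw hE
    refine ⟨(fun d => {PatchGen.r d}) '' (D : Set S), D.finite_toSet.image _,
      patchCov_r (hD a' rfl) ha', ?_⟩
    rintro _ ⟨d, hd, rfl⟩
    obtain ⟨c, hc, hdc⟩ := hD' d hd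
    obtain ⟨_, rfl, hca⟩ := hE' c hc
    exact ⟨_, ⟨c, hca, rfl⟩, GenRefines_singleton hdc⟩
  | L1 =>
    refine ⟨{{PatchGen.l ∅}}, Set.finite_singleton _,
      GCov_ax PatchThy.L1 (Finset.empty_subset X), ?_⟩
    rintro _ rfl
    exact ⟨_, rfl, GenRefines_singleton (wbS_of_forall_exists_wb hbc ∅ (by simp))⟩
  | L2 A B hAB =>
    obtain ⟨C, hC, hBC⟩ := hX.exists_l (A := B) (by simp)
    refine ⟨{{PatchGen.l C}}, Set.finite_singleton _, GCov_singleton (by simpa using hC), ?_⟩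
    rintro _ rfl
    exact ⟨_, rfl, GenRefines_singleton (wbS_of_covS_of_wbS hbc hAB hBC)⟩
  | L3 A B =>
    obtain ⟨A', hA', hAA⟩ := hX.exists_l (A := A) (by simp)
    obtain ⟨B', hB', hBB⟩ := hX.exists_l (A := B) (by simp)
    refine ⟨{{PatchGen.l (A' ∪ B')}}, Set.finite_singleton _,
      patchCov_l_union hbc hA' hB', ?_⟩
    rintro _ rfl
    have hU : wbS cov (↑A ∪ ↑B) (↑A' ∪ ↑B') := wbS_union hbc
      (wbS_of_wbS_of_covS hbc hAA (covS_of_subset hbc Set.subset_union_left))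
      (wbS_of_wbS_of_covS hbc hBB (covS_of_subset hbc Set.subset_union_right))
    obtain ⟨C, hC, hC'⟩ := exists_wbS_interpolant hbc hw hU
    refine ⟨_, ⟨C,
      wbS_of_covS_of_wbS hbc (covS_of_subset hbc Set.subset_union_left) hC,
      wbS_of_covS_of_wbS hbc (covS_of_subset hbc Set.subset_union_right) hC, rfl⟩,
      GenRefines_singleton (wbS_of_forall_exists_wb hbc C (by simpa using hC'))⟩
  | Loc a b hab =>
    obtain ⟨E, hE, hE'⟩ := exists_wbS_interpolant hbc hw (wbS_singleton.2 hab)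
    obtain ⟨D, hD, hD'⟩ := exists_wbS_interpolant hbc hw hE
    refine ⟨_, (E.finite_toSet.image _).insert _, patchCov_loc hbc hD' X, ?_⟩
    rintro _ (rfl | ⟨e, he, rfl⟩)
    · refine ⟨_, Or.inl rfl, GenRefines_singleton ?_⟩
      simpa [genWB] using hD
    · obtain ⟨_, rfl, heb⟩ := hE' e he
      exact ⟨_, Or.inr rfl, GenRefines_singleton heb⟩
  | D a =>
    obtain ⟨a', ha', haa⟩ := hX.exists_r (a := a) (by simp)
    obtain ⟨B, hB, haB⟩ := hX.exists_l (A := {a}) (by simp)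
    refine ⟨∅, Set.finite_empty, patchCov_empty_of_mem hbc ?_ ha' hB, by simp⟩
    rw [Finset.coe_singleton] at haB
    exact covS_trans hbc (covS_of_wbS hbc (wbS_singleton.2 haa)) (covS_of_wbS hbc haB) a' rfl

/-- Covers in the patch have finite subcovers on refinements that lie in a way-below
part of `S`. -/
theorem FinGCov_of_GenRefines (hft : IsFormalTopology cov le) {w : S → Set S}
    (hw : IsContinuous cov w) (hst : Stable cov le)
    {A : Finset (PatchGen S)} {𝒰 : Set (Finset (PatchGen S))} (h : patchCov cov le A 𝒰)
    {X : Finset (PatchGen S)} (hr : ∃ c d, PatchGen.r c ∈ X ∧ wb cov c d)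
    (hX : GenRefines cov X A) : FinGCov (PatchThy cov le) X 𝒰 := by
  unfold patchCov at h
  induction h generalizing X with
  | @refl A 𝒰 hA =>
    exact ⟨{A}, Set.singleton_subset_iff.2 hA, Set.finite_singleton A,
      patchCov_of_GenRefines hft.1 hX⟩
  | le hBA _ ih => exact ih hr fun g hg => hX g (hBA hg)
  | ax C hT _ ih =>
    obtain ⟨𝒱, hfin, hcov, hV⟩ := exists_finite_refinement hft hw hst hT hr
      fun g hg => hX g (Finset.mem_union_right C hg)
    refine FinGCov_of_subset hcov subset_rfl hfin fun V hV' => ?_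
    obtain ⟨B, hB, hVB⟩ := hV V hV'
    obtain ⟨c, d, hc, hcd⟩ := hr
    exact ih B hB ⟨c, d, Finset.mem_union_left V hc, hcd⟩
      (GenRefines_union (fun g hg => hX g (Finset.mem_union_left _ hg)) hVB)

theorem wb_patchCov (hft : IsFormalTopology cov le) {w : S → Set S}
    (hw : IsContinuous cov w) (hst : Stable cov le) {X A : Finset (PatchGen S)}
    (hr : ∃ c d, PatchGen.r c ∈ X ∧ wb cov c d) (hX : GenRefines cov X A) :
    wb (patchCov cov le) X A := by
  intro 𝒰 h𝒰
  obtain ⟨𝒰₀, hsub, hfin, hc⟩ := FinGCov_of_GenRefines hft hw hst h𝒰 hr hX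
  exact ⟨hfin.toFinset, by simpa using hsub, by rwa [hfin.coe_toFinset]⟩

theorem patchCov_GenRefines_r (A : Finset (PatchGen S)) :
    patchCov cov le A
      {X | (∃ c d, PatchGen.r c ∈ X ∧ wb cov c d) ∧ GenRefines cov X A} := by
  refine GCov_of_subset (GCov_ax PatchThy.R1 (Finset.empty_subset A)) subset_rfl ?_
  rintro _ ⟨a, rfl⟩
  refine GCov_mono (GCov_refinements patchCov_genWB _) ?_
  intro X (hX : GenRefines cov X _)
  obtain ⟨c, hc, hca⟩ := hX.exists_r (a := a) (by simp)
  exact ⟨⟨c, a, hc, hca⟩, fun g hg => hX g (Finset.mem_union_left _ hg)⟩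

theorem mem_star_patchCov {X B : Finset (PatchGen S)}
    (h : patchCov cov le (X ∪ B) ∅) : X ∈ star (patchCov cov le) supord B := by
  rintro C ⟨_, rfl, _, rfl, hX, hB⟩
  exact GCov.le (Finset.union_subset hX hB) h

theorem patchCov_star_of_genWB (hbc : IsBasicCover cov) {w : S → Set S}
    (hw : IsContinuous cov w) {g g' : PatchGen S} {X : Finset (PatchGen S)}
    (h : genWB cov g' g) (hX : g' ∈ X) :
    patchCov cov le ∅ (star (patchCov cov le) supord X ∪ {{g}}) := by
  match g, g', h with
  | PatchGen.r a, PatchGen.r a', h =>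
    refine GCov_mono (GCov_ax (PatchThy.Loc a' a h) subset_rfl) ?_
    rintro _ (rfl | rfl)
    · exact Or.inl (mem_star_patchCov
        (GCov_ax (PatchThy.D a') (by simp [Finset.insert_subset_iff, hX])))
    · exact Or.inr rfl
  | PatchGen.l A, PatchGen.l B, h =>
    obtain ⟨D, hD, hD'⟩ := exists_wbS_interpolant hbc hw h
    refine GCov_trans (patchCov_loc hbc hD' ∅) ?_
    rintro _ (rfl | ⟨b, hb, rfl⟩)
    · exact GCov_mono (patchCov_l (covS_of_wbS hbc hD) (by simp)) Set.subset_union_right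
    · exact GCov.refl (Or.inl (mem_star_patchCov
        (patchCov_empty_of_mem hbc (hbc.1 b _ hb) (by simp) (by simp [hX]))))

theorem wc_patchCov_of_GenRefines (hbc : IsBasicCover cov) {w : S → Set S}
    (hw : IsContinuous cov w) {X A : Finset (PatchGen S)} (h : GenRefines cov X A) :
    wc (patchCov cov le) supord X A := by
  intro Y _
  refine GCov_union_singleton fun g hg => ?_
  obtain ⟨g', hg', hgg⟩ := h g hg
  exact patchCov_star_of_genWB hbc hw hgg hg'

end Patch

/-- For every stably locally compact formal topology `S`, the
patch `Patch(S)` is a locally compact regular formal topology. -/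
theorem patch_locally_compact_regular {S : Type u}
    (cov : S → Set S → Prop) (le : S → S → Prop)
    (hft : IsFormalTopology cov le) (w : S → Set S) (hw : IsContinuous cov w)
    (hst : Stable cov le) :
    (∃ wP : Finset (PatchGen S) → Set (Finset (PatchGen S)),
        IsContinuous (patchCov cov le) wP) ∧
    Regular (patchCov cov le) supord := by
  refine ⟨⟨fun A => {X | wb (patchCov cov le) X A}, fun _ _ h => h, fun A => ?_⟩, fun A => ?_⟩
  · exact GCov_mono (patchCov_GenRefines_r A) fun X hX => wb_patchCov hft hw hst hX.1 hX.2
  · exact GCov_mono (patchCov_GenRefines_r A) fun X hX =>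
      wc_patchCov_of_GenRefines hft.1 hw hX.2

end FTP
end
end
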